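/- arXiv:2401.03011 — 5 statements merged into one kernel-verified Lean document; each statement's English description precedes it below -/
import Mathlib

section
/- Let G be a finite simple graph that admits a proper 3-coloring. Then G is 3-mixing if and only if G is bipartite and every proper 3-coloring of G can be transformed into a proper 3-coloring that uses at most 2 distinct colors. -/
/-- A proper `k`-coloring of `G`: adjacent vertices receive distinct colors. -/
def Proper {V : Type*} (G : SimpleGraph V) (k : ℕ) (c : V → Fin k) : Prop :=
  ∀ ⦃u v : V⦄, G.Adj u v → c u ≠ c v

/-- Two proper `k`-colorings are adjacent if they differ on exactly one vertex. -/
def ColAdj {V : Type*} (G : SimpleGraph V) (k : ℕ) (c c' : V → Fin k) : Prop :=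
  Proper G k c ∧ Proper G k c' ∧ ∃! v, c v ≠ c' v

/-- `c` can be transformed into `c'` via single-vertex recolorings through
proper `k`-colorings. -/
def Reach {V : Type*} (G : SimpleGraph V) (k : ℕ) : (V → Fin k) → (V → Fin k) → Prop :=
  Relation.ReflTransGen (ColAdj G k)

/-- `G` is `k`-mixing: any proper `k`-coloring can be transformed into any other. -/
def Mixing {V : Type*} (G : SimpleGraph V) (k : ℕ) : Prop :=
  ∀ c c' : V → Fin k, Proper G k c → Proper G k c' → Reach G k c c'

/-- `G` is bipartite: it admits a proper `2`-coloring. -/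
def Bipartite {V : Type*} (G : SimpleGraph V) : Prop :=
  ∃ c : V → Fin 2, Proper G 2 c

/-- The join of `B` with the complete graph on `m` vertices. -/
def JoinK {V : Type*} (B : SimpleGraph V) (m : ℕ) : SimpleGraph (V ⊕ Fin m) :=
  SimpleGraph.fromRel fun x y =>
    match x, y with
    | Sum.inl u, Sum.inl v => B.Adj u v
    | Sum.inl _, Sum.inr _ => True
    | Sum.inr _, Sum.inl _ => True
    | Sum.inr i, Sum.inr j => i ≠ j

/-- The signed cyclic step from `a` to `b` in `Fin 3`: the representative of `b - a` in
`{-1, 0, 1}`. -/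
def cyclicStep (a b : Fin 3) : ℤ :=
  if b = a then 0 else if b = a + 1 then 1 else -1

theorem cyclicStep_neg (a b : Fin 3) : cyclicStep (-a) (-b) = -cyclicStep a b := by
  revert a b; decide

theorem cyclicStep_of_ne {a b : Fin 3} (h : a ≠ b) : cyclicStep a b = 1 ∨ cyclicStep a b = -1 := by
  revert a b; decide

theorem cyclicStep_sub {a b a' b' : Fin 3} (h : a ≠ b) (h' : a' ≠ b') (hab : a = a' ∨ b = b') :
    cyclicStep a' b' - cyclicStep a b = 2 * (cyclicStep b' b - cyclicStep a' a) := by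
  revert a b a' b'; decide

/-- Along a sequence of recolorings, the cyclic steps of the edges change by twice the
differences of a potential on the vertices. -/
theorem Reach.exists_potential {V : Type*} {G : SimpleGraph V} {c c' : V → Fin 3}
    (h : Reach G 3 c c') :
    ∃ K : V → ℤ, ∀ ⦃u w⦄, G.Adj u w →
      cyclicStep (c' u) (c' w) - cyclicStep (c u) (c w) = 2 * (K w - K u) := by
  induction h with
  | refl => exact ⟨0, fun u w _ => by simp⟩
  | @tail d d' _ hd ih =>
    obtain ⟨K, hK⟩ := ih
    obtain ⟨hp, hp', v, -, hv⟩ := hd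
    refine ⟨fun x => K x + cyclicStep (d' x) (d x), fun u w huw => ?_⟩
    have hor : d u = d' u ∨ d w = d' w := by
      by_contra! hne
      exact huw.ne ((hv u hne.1).trans (hv w hne.2).symm)
    have h₁ := hK huw
    have h₂ := cyclicStep_sub (hp huw) (hp' huw) hor
    linarith

theorem Mixing.bipartite {V : Type*} {G : SimpleGraph V} (hG : ∃ c : V → Fin 3, Proper G 3 c)
    (h : Mixing G 3) : Bipartite G := by
  obtain ⟨c, hc⟩ := hG
  have hneg : Proper G 3 fun v => -c v := fun u v huv => neg_injective.ne (hc huv)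
  obtain ⟨K, hK⟩ := (h c _ hc hneg).exists_potential
  refine ⟨fun v => if Even (K v) then 0 else 1, fun u w huw => ?_⟩
  have hstep := hK huw
  rw [cyclicStep_neg] at hstep
  have hodd : Even (K w) ↔ ¬ Even (K u) := by
    rcases cyclicStep_of_ne (hc huw) with h₁ | h₁ <;> rw [h₁] at hstep <;>
      simp only [Int.even_iff] <;> omega
  by_cases hu : Even (K u) <;> simp [hodd, hu]

/-- Two proper colorings that differ on an independent set can be transformed into each other. -/
theorem Reach.of_independent {V : Type*} [Finite V] {G : SimpleGraph V} {k : ℕ}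
    {c c' : V → Fin k} (hc : Proper G k c) (hc' : Proper G k c')
    (hind : ∀ ⦃u v⦄, G.Adj u v → c u = c' u ∨ c v = c' v) : Reach G k c c' := by
  classical
  induction hn : {v | c v ≠ c' v}.ncard generalizing c with
  | zero =>
    rw [Set.ncard_eq_zero, Set.eq_empty_iff_forall_notMem] at hn
    have : c = c' := funext fun v => not_not.mp (hn v)
    exact this ▸ Relation.ReflTransGen.refl
  | succ n ih =>
    obtain ⟨v, hv⟩ : {v | c v ≠ c' v}.Nonempty := by
      rw [← Set.ncard_pos]; omega
    have hv : c v ≠ c' v := hv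
    have hupd : Proper G k (Function.update c v (c' v)) := by
      intro x y hxy
      have h₁ := hind hxy
      have h₂ := hc hxy
      have h₃ := hc' hxy
      have h₄ := hxy.ne
      simp only [Function.update_apply]
      grind
    refine Relation.ReflTransGen.head (b := Function.update c v (c' v))
      ⟨hc, hupd, v, by simpa using hv, fun x hx => ?_⟩ (ih hupd (fun x y hxy => ?_) ?_)
    · by_contra hne
      exact hx (by simp [hne])
    · have := hind hxy
      simp only [Function.update_apply]
      grind
    · have : {x | Function.update c v (c' v) x ≠ c' x} = {x | c x ≠ c' x} \ {v} := by
        ext x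
        simp only [Function.update_apply, Set.mem_sdiff, Set.mem_ofPred_eq, Set.mem_singleton_iff]
        grind
      rw [this, Set.ncard_sdiff_singleton_of_mem hv, hn, Nat.add_sub_cancel]

theorem ColAdj.symm {V : Type*} {G : SimpleGraph V} {k : ℕ} {c c' : V → Fin k}
    (h : ColAdj G k c c') : ColAdj G k c' c :=
  ⟨h.2.1, h.1, by simpa only [ne_comm] using h.2.2⟩

theorem Reach.symm {V : Type*} {G : SimpleGraph V} {k : ℕ} {c c' : V → Fin k}
    (h : Reach G k c c') : Reach G k c' c := by
  induction h with
  | refl => exact Relation.ReflTransGen.refl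
  | tail _ hd ih => exact Relation.ReflTransGen.head hd.symm ih

theorem Reach.proper {V : Type*} {G : SimpleGraph V} {k : ℕ} {c c' : V → Fin k}
    (h : Reach G k c c') (hc : Proper G k c) : Proper G k c' := by
  induction h with
  | refl => exact hc
  | tail _ hd _ => exact hd.2.1


/-- Two proper `3`-colorings that miss the same color can be transformed into each other. -/
theorem Reach.of_forall_ne {V : Type*} [Finite V] {G : SimpleGraph V} {c d : V → Fin 3}
    (hc : Proper G 3 c) (hd : Proper G 3 d) {x : Fin 3} (hcx : ∀ v, c v ≠ x)
    (hdx : ∀ v, d v ≠ x) : Reach G 3 c d := by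
  obtain ⟨a, ha⟩ : ∃ a, a ≠ x := exists_ne x
  let e₁ : V → Fin 3 := fun v => if c v ≠ d v ∧ c v = a then x else c v
  let e₂ : V → Fin 3 := fun v => if c v ≠ d v ∧ c v = a then x else d v
  have key : ∀ ⦃u v⦄, G.Adj u v → c u ≠ c v ∧ d u ≠ d v ∧ (c u = d u ↔ c v = d v) ∧
      (c u = a ∨ c v = a) := by
    intro u v huv
    have := hc huv
    have := hd huv
    have := hcx u
    have := hcx v
    have := hdx u
    have := hdx v
    refine ⟨by assumption, by assumption, by omega, by omega⟩
  have he₁ : Proper G 3 e₁ := by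
    intro u v huv
    have := key huv
    have := hcx u
    have := hcx v
    simp only [e₁]
    grind
  have he₂ : Proper G 3 e₂ := by
    intro u v huv
    have := key huv
    have := hdx u
    have := hdx v
    simp only [e₂]
    grind
  refine ((Reach.of_independent hc he₁ ?_).trans (Reach.of_independent he₁ he₂ ?_)).trans
    (Reach.of_independent he₂ hd ?_) <;>
  · intro u v huv
    have := key huv
    simp only [e₁, e₂]
    grind

theorem exists_forall_ne_of_ncard_range_le {V : Type*} {c : V → Fin 3}
    (h : (Set.range c).ncard ≤ 2) : ∃ x, ∀ v, c v ≠ x := by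
  by_contra! hsurj
  rw [Set.range_eq_univ.mpr hsurj, Set.ncard_univ, Nat.card_fin] at h
  omega

/-- Any two proper `3`-colorings that use at most two colors each can be transformed into each
other. -/
theorem Reach.of_ncard_range_le {V : Type*} [Finite V] {G : SimpleGraph V} {c d : V → Fin 3}
    (hc : Proper G 3 c) (hd : Proper G 3 d) (hc₂ : (Set.range c).ncard ≤ 2)
    (hd₂ : (Set.range d).ncard ≤ 2) : Reach G 3 c d := by
  obtain ⟨x, hx⟩ := exists_forall_ne_of_ncard_range_le hc₂
  obtain ⟨y, hy⟩ := exists_forall_ne_of_ncard_range_le hd₂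
  let e : V → Fin 3 := fun v => if c v = y then x else c v
  have he : Proper G 3 e := by
    intro u v huv
    have := hc huv
    have := hx u
    have := hx v
    simp only [e]
    grind
  refine (Reach.of_independent hc he fun u v huv => ?_).trans
    (Reach.of_forall_ne he hd (fun v => ?_) hy)
  · have := hc huv
    simp only [e]
    grind
  · have := hx v
    simp only [e]
    grind

/-- A `3`-colorable graph `G` is `3`-mixing iff it is bipartite and
every proper `3`-coloring can be transformed into one using at most `2` colors. -/
theorem stmt0 {V : Type*} [Fintype V] (G : SimpleGraph V)
    (hG : ∃ c : V → Fin 3, Proper G 3 c) :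
    Mixing G 3 ↔
      (Bipartite G ∧
        ∀ c : V → Fin 3, Proper G 3 c →
          ∃ c' : V → Fin 3, Reach G 3 c c' ∧ (Set.range c').ncard ≤ 2) := by
  refine ⟨fun h => ⟨h.bipartite hG, fun c hc => ?_⟩, fun ⟨_, h⟩ c d hc hd => ?_⟩
  · obtain ⟨f, hf⟩ := h.bipartite hG
    refine ⟨Fin.castSucc ∘ f, h _ _ hc fun u v huv => (Fin.castSucc_injective 2).ne (hf huv), ?_⟩
    rw [Set.range_comp]
    calc _ ≤ (Set.range f).ncard := Set.ncard_image_le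
      _ ≤ Nat.card (Fin 2) := Set.ncard_le_card _
      _ = 2 := Nat.card_fin 2
  · obtain ⟨c', hcc', hc'⟩ := h c hc
    obtain ⟨d', hdd', hd'⟩ := h d hd
    exact (hcc'.trans (Reach.of_ncard_range_le (hcc'.proper hc) (hdd'.proper hd) hc' hd')).trans
      hdd'.symm
end

section
/- Let G be a finite simple graph and let c and c' be proper 3-colorings of G (with colors in {0,1,2}) such that c takes values only in {1,2} and c' takes values only in {0,1}. Then c can be transformed into c' by single-vertex recolorings through proper 3-colorings: first recolor, one by one, every vertex v with c'(v) = 0 to color 0, and then recolor, one by one, every vertex v with c'(v) = 1 to color 1. -/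
/-- If replacing `f` by `g` on any subset of `S` gives a proper coloring, then `f` can be
transformed into the coloring that agrees with `g` on `S` and with `f` elsewhere. -/
theorem reach_piecewise {V : Type*} [DecidableEq V] {G : SimpleGraph V} {k : ℕ}
    {f g : V → Fin k} (S : Finset V) (h : ∀ T ⊆ S, Proper G k (T.piecewise g f)) :
    Reach G k f (S.piecewise g f) := by
  induction S using Finset.induction_on with
  | empty =>
    rw [Finset.piecewise_empty]
    exact Relation.ReflTransGen.refl
  | insert a S ha ih =>
    have hS : Reach G k f (S.piecewise g f) :=
      ih fun T hT => h T (hT.trans (Finset.subset_insert a S))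
    have hne : ∀ v, v ≠ a → S.piecewise g f v = (insert a S).piecewise g f v := by
      intro v hv
      simp [Finset.piecewise, hv]
    by_cases hfg : f a = g a
    · have heq : (insert a S).piecewise g f = S.piecewise g f := by
        funext v
        by_cases hv : v = a
        · subst hv
          simp [ha, hfg]
        · exact (hne v hv).symm
      rwa [heq]
    · refine Relation.ReflTransGen.tail hS
        ⟨h S (Finset.subset_insert a S), h _ (Finset.Subset.refl _), a, ?_, ?_⟩
      · simpa [ha] using hfg
      · intro v hv
        by_contra hva
        exact hv (hne v hva)

/-- a proper `3`-coloring with values in `{1,2}` can be transformed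
into a proper `3`-coloring with values in `{0,1}`. -/
theorem stmt2 {V : Type*} [Fintype V] (G : SimpleGraph V)
    (c c' : V → Fin 3) (hc : Proper G 3 c) (hc' : Proper G 3 c')
    (hcval : ∀ v, c v = 1 ∨ c v = 2)
    (hc'val : ∀ v, c' v = 0 ∨ c' v = 1) :
    Reach G 3 c c' := by
  classical
  let A : Finset V := Finset.univ.filter fun v => c' v = 0
  have hA : ∀ v, v ∈ A ↔ c' v = 0 := fun v => by simp [A]
  have toZero : Reach G 3 c (A.piecewise c' c) := by
    refine reach_piecewise A fun T hT u v huv => ?_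
    have hu : u ∈ T → c' u = 0 := fun h => (hA u).1 (hT h)
    have hv : v ∈ T → c' v = 0 := fun h => (hA v).1 (hT h)
    have := hc huv
    have := hc' huv
    have := hcval u
    have := hcval v
    simp only [Finset.piecewise]
    grind
  have toOne : Reach G 3 (A.piecewise c' c)
      (Finset.univ.piecewise c' (A.piecewise c' c)) := by
    refine reach_piecewise Finset.univ fun T _ u v huv => ?_
    have := hA u
    have := hA v
    have := hc' huv
    have := hcval u
    have := hcval v
    have := hc'val u
    have := hc'val v
    simp only [Finset.piecewise]
    grind
  rw [Finset.piecewise_univ] at toOne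
  exact toZero.trans toOne
end

section
/- Let k ≥ 4, let B be a finite simple graph on vertex set V, and let G be the join of B with the complete graph on k−3 vertices. Let c be a proper 3-coloring of B (viewed with values in {0,1,2} ⊆ Fin k) such that c cannot be transformed, within proper colorings of B taking values in {0,1,2}, into a coloring using at most 2 distinct colors. Define the proper k-coloring c̃ of G by c̃(inl v) = c(v) for v ∈ V and c̃(inr i) = 3 + i for i ∈ Fin (k−3). Then every proper k-coloring d of G that is reachable from c̃ satisfies d(inr i) = c̃(inr i) for all i ∈ Fin (k−3), and d(inl v) ∈ {0,1,2} for all v ∈ V. -/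
theorem surjective_of_two_lt_ncard_range {V : Type*} {e : V → Fin 3}
    (h : 2 < (Set.range e).ncard) : Function.Surjective e := by
  rw [← Set.range_eq_univ]
  refine Set.eq_of_subset_of_ncard_le (Set.subset_univ _) ?_
  rw [Set.ncard_univ, Nat.card_fin]
  exact h

theorem joinK_adj_inl_inl {V : Type*} {B : SimpleGraph V} {m : ℕ} {u v : V} (h : B.Adj u v) :
    (JoinK B m).Adj (Sum.inl u) (Sum.inl v) := by
  simp [JoinK, h, h.ne]

theorem joinK_adj_inl_inr {V : Type*} (B : SimpleGraph V) {m : ℕ} (v : V) (i : Fin m) :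
    (JoinK B m).Adj (Sum.inl v) (Sum.inr i) := by
  simp [JoinK]

theorem joinK_adj_inr_inr {V : Type*} (B : SimpleGraph V) {m : ℕ} {i j : Fin m} (h : i ≠ j) :
    (JoinK B m).Adj (Sum.inr i) (Sum.inr j) := by
  simp [JoinK, h]

/-- A proper coloring of the join restricts to a proper coloring of the base graph. -/
theorem Proper.of_joinK {V : Type*} {B : SimpleGraph V} {m k n : ℕ} {d : V ⊕ Fin m → Fin k}
    {e : V → Fin n} (hd : Proper (JoinK B m) k d)
    (hl : ∀ v, (d (Sum.inl v)).val = (e v).val) : Proper B n e := fun u v huv heq =>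
  hd (joinK_adj_inl_inl huv) (Fin.ext (by rw [hl, hl, heq]))

/-- If the clique of the join uses the colors `3, …, k - 1` and the base graph uses exactly the
colors `0, 1, 2`, then a single recoloring changes only the base graph, within `0, 1, 2`. -/
theorem colAdj_joinK_step {V : Type*} {k : ℕ} {B : SimpleGraph V}
    {d d' : V ⊕ Fin (k - 3) → Fin k} {e : V → Fin 3} (he : Function.Surjective e)
    (h : ColAdj (JoinK B (k - 3)) k d d') (hl : ∀ v, (d (Sum.inl v)).val = (e v).val)
    (hr : ∀ i, (d (Sum.inr i)).val = 3 + i.val) :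
    ∃ e' : V → Fin 3, Reach B 3 e e' ∧ (∀ v, (d' (Sum.inl v)).val = (e' v).val) ∧
      ∀ i, (d' (Sum.inr i)).val = 3 + i.val := by
  obtain ⟨hd, hd', w, hw, huniq⟩ := h
  have hsame : ∀ x, x ≠ w → d' x = d x := fun x hx => by
    by_contra hne
    exact hx (huniq x (Ne.symm hne))
  rcases w with v | i
  · have hr' : ∀ i, (d' (Sum.inr i)).val = 3 + i.val := fun i => by
      rw [hsame _ Sum.inr_ne_inl, hr]
    have hlt : ∀ u, (d' (Sum.inl u)).val < 3 := fun u => by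
      by_contra hge
      have hk := (d' (Sum.inl u)).isLt
      refine hd' (joinK_adj_inl_inr B u ⟨(d' (Sum.inl u)).val - 3, by omega⟩) (Fin.ext ?_)
      rw [hr']
      dsimp only
      omega
    refine ⟨fun u => ⟨_, hlt u⟩, Relation.ReflTransGen.single
      ⟨hd.of_joinK hl, hd'.of_joinK fun _ => rfl, v, ?_, ?_⟩, fun _ => rfl, hr'⟩
    · intro heq
      exact hw (Fin.ext ((hl v).trans (congrArg Fin.val heq)))
    · intro u hu
      by_contra huv
      refine hu (Fin.ext ?_)
      dsimp only
      rw [hsame _ (Sum.inl_injective.ne huv), hl]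
  · exfalso
    have hk := (d' (Sum.inr i)).isLt
    by_cases hlt : (d' (Sum.inr i)).val < 3
    · obtain ⟨v, hv⟩ := he ⟨_, hlt⟩
      refine hd' (joinK_adj_inl_inr B v i) (Fin.ext ?_)
      rw [hsame _ Sum.inl_ne_inr, hl, hv]
    · obtain ⟨j, hj⟩ : ∃ j : Fin (k - 3), (d' (Sum.inr i)).val = 3 + j.val :=
        ⟨⟨(d' (Sum.inr i)).val - 3, by omega⟩, by dsimp only; omega⟩
      have hij : i ≠ j := by
        rintro rfl
        exact hw (Fin.ext ((hr i).trans hj.symm))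
      refine hd' (joinK_adj_inr_inr B hij) (Fin.ext ?_)
      rw [hsame _ (Sum.inr_injective.ne hij.symm), hr, hj]

/-- if the `3`-coloring `c` of `B` cannot reach a coloring with at
most `2` colors, then from the coloring `c̃` of the join (agreeing with `c` on `B`
and coloring the clique with colors `3, 4, …, k-1`) no reachable coloring ever
recolors the clique, and `B` stays colored within `{0,1,2}`. -/
theorem stmt5 {V : Type*} [Fintype V] (k : ℕ) (hk : 4 ≤ k)
    (B : SimpleGraph V) (c : V → Fin 3) (hc : Proper B 3 c)
    (hnot : ¬ ∃ c' : V → Fin 3, Reach B 3 c c' ∧ (Set.range c').ncard ≤ 2)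
    (d : (V ⊕ Fin (k - 3)) → Fin k)
    (hd : Reach (JoinK B (k - 3)) k
      (Sum.elim (fun v => Fin.castLE (by omega) (c v))
        (fun i => ⟨3 + i.val, by have := i.isLt; omega⟩)) d) :
    (∀ i : Fin (k - 3), (d (Sum.inr i)).val = 3 + i.val) ∧
      (∀ v : V, (d (Sum.inl v)).val < 3) := by
  suffices h : ∃ e : V → Fin 3, Reach B 3 c e ∧ (∀ v, (d (Sum.inl v)).val = (e v).val) ∧
      ∀ i : Fin (k - 3), (d (Sum.inr i)).val = 3 + i.val by
    obtain ⟨e, -, hl, hr⟩ := h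
    exact ⟨hr, fun v => by rw [hl v]; exact (e v).isLt⟩
  induction hd with
  | refl => exact ⟨c, Relation.ReflTransGen.refl, fun _ => rfl, fun _ => rfl⟩
  | tail _ hstep ih =>
    obtain ⟨e, hce, hl, hr⟩ := ih
    have he : Function.Surjective e :=
      surjective_of_two_lt_ncard_range (by_contra fun h => hnot ⟨e, hce, not_lt.1 h⟩)
    obtain ⟨e', hee', hl', hr'⟩ := colAdj_joinK_step he hstep hl hr
    exact ⟨e', hce.trans hee', hl', hr'⟩
end

section
/- Let k ≥ 4, let B be a finite bipartite simple graph on vertex set V, and let G be the join of B with the complete graph on k−3 vertices. If every proper 3-coloring of B can be transformed (within proper 3-colorings of B) into a proper 3-coloring using at most 2 distinct colors, then G is k-mixing. -/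
/-- If the colors of `c` and `c'` never clash across an edge, the vertices can be recolored from
`c` to `c'` one at a time, in any order. -/
theorem reach_of_forall_adj_ne {V : Type*} [Finite V] {G : SimpleGraph V} {k : ℕ}
    {c c' : V → Fin k} (hc : Proper G k c) (hc' : Proper G k c')
    (hcc' : ∀ ⦃u v⦄, G.Adj u v → c u ≠ c' v) : Reach G k c c' := by
  classical
  have := Fintype.ofFinite V
  have hmix (S : Finset V) : Proper G k (S.piecewise c' c) := by
    intro u v huv
    by_cases hu : u ∈ S <;> by_cases hv : v ∈ S <;> simp only [Finset.piecewise, hu, hv, if_true,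
      if_false]
    exacts [hc' huv, (hcc' huv.symm).symm, hcc' huv, hc huv]
  suffices ∀ S : Finset V, Reach G k c (S.piecewise c' c) by
    simpa using this Finset.univ
  intro S
  induction S using Finset.induction_on with
  | empty => rw [Finset.piecewise_empty]; exact .refl
  | insert a S ha ih =>
    by_cases hca : c a = c' a
    · convert ih using 1
      ext v
      by_cases hv : v = a
      · subst hv; simp [ha, hca]
      · simp [Finset.piecewise, hv]
    · refine ih.tail ⟨hmix S, hmix _, a, by simpa [ha] using hca, fun v hv => ?_⟩
      by_contra hva
      simp [Finset.piecewise, hva] at hv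

/-- Recoloring sequences pull back along graph homomorphisms. -/
theorem Reach.comp_hom {V W : Type*} [Finite V] {G : SimpleGraph V} {H : SimpleGraph W} {k : ℕ}
    (φ : G →g H) {c c' : W → Fin k} (h : Reach H k c c') : Reach G k (c ∘ φ) (c' ∘ φ) := by
  induction h with
  | refl => exact .refl
  | @tail c₁ c₂ _ hadj ih =>
    obtain ⟨h₁, h₂, w, -, huniq⟩ := hadj
    refine ih.trans (reach_of_forall_adj_ne (fun u v huv => h₁ (φ.map_rel huv))
      (fun u v huv => h₂ (φ.map_rel huv)) fun u v huv heq => ?_)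
    have huv' := φ.map_rel huv
    have hu : c₁ (φ u) ≠ c₂ (φ u) := fun h => h₂ huv' (h.symm.trans heq)
    have hv : c₁ (φ v) ≠ c₂ (φ v) := fun h => h₁ huv' (heq.trans h.symm)
    exact huv'.ne ((huniq _ hu).trans (huniq _ hv).symm)

theorem proper_top_iff {W : Type*} {k : ℕ} {g : W → Fin k} :
    Proper ⊤ k g ↔ Function.Injective g := by
  refine ⟨fun h u v huv => by_contra fun hne => h hne huv, fun h u v huv heq => ?_⟩
  exact ((SimpleGraph.top_adj _ _).1 huv) (h heq)

/-- Moving one vertex of a complete graph to an unused color. -/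
theorem colAdj_top_update {W : Type*} [DecidableEq W] {k : ℕ} {g : W → Fin k}
    (hg : Function.Injective g) (w : W) {d : Fin k} (hd : ∀ v, g v ≠ d) :
    ColAdj ⊤ k g (Function.update g w d) := by
  refine ⟨proper_top_iff.2 hg, proper_top_iff.2 fun u v huv => ?_, w, by simpa using hd w,
    fun v hv => ?_⟩
  · simp only [Function.update_apply] at huv
    split_ifs at huv with hu hv hv
    exacts [hu.trans hv.symm, (hd _ huv.symm).elim, (hd _ huv).elim, hg huv]
  · by_contra hvw
    simp [hvw] at hv

/-- A complete graph with fewer than `k` vertices is `k`-mixing. -/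
theorem mixing_top {W : Type*} [Fintype W] {k : ℕ} (hk : Fintype.card W < k) :
    Mixing (⊤ : SimpleGraph W) k := by
  classical
  intro g g' hg hg'
  rw [proper_top_iff] at hg hg'
  induction hn : (Finset.univ.filter fun w => g w ≠ g' w).card using Nat.strong_induction_on
    generalizing g with
  | _ n ih =>
  by_cases heq : g = g'
  · exact heq ▸ .refl
  obtain ⟨w, hw⟩ := Function.ne_iff.1 heq
  have key (f : W → Fin k) (hf : Function.Injective f) (hfw : f w ≠ g' w)
      (hsub : ∀ v, g v = g' v → f v = g' v) (hfree : ∀ v, f v ≠ g' w) : Reach ⊤ k f g' := by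
    have hadj := colAdj_top_update hf w hfree
    refine .head hadj (ih _ ?_ _ (proper_top_iff.1 hadj.2.1) rfl)
    rw [← hn]
    refine Finset.card_lt_card ⟨fun v hv => ?_, fun hle => ?_⟩
    · simp only [Finset.mem_filter, Finset.mem_univ, true_and] at hv ⊢
      rintro hgv
      by_cases hvw : v = w
      · subst hvw; exact hw hgv
      · exact hv (by simpa [hvw] using hsub v hgv)
    · simpa using hle (by simpa using hw : w ∈ Finset.univ.filter fun w => g w ≠ g' w)
  by_cases hfree : ∀ v, g v ≠ g' w
  · exact key g hg hw (fun _ h => h) hfree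
  push Not at hfree
  obtain ⟨x, hx⟩ := hfree
  have hxw : x ≠ w := by rintro rfl; exact hw hx
  obtain ⟨d, hd⟩ : ∃ d, ∀ v, g v ≠ d := by
    by_contra! h
    have := Fintype.card_le_of_surjective g h
    simp at this
    omega
  have hadj := colAdj_top_update hg x hd
  refine .head hadj (key _ (proper_top_iff.1 hadj.2.1) (by simpa [hxw.symm] using hw) ?_ ?_)
  · intro v hv
    have hvx : v ≠ x := by
      rintro rfl
      exact hxw (hg' (hv.symm.trans hx))
    simpa [hvx] using hv
  · intro v
    by_cases hvx : v = x
    · subst hvx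
      simpa [← hx] using (hd v).symm
    · simpa [hvx, ← hx] using fun h => hvx (hg h)

/-- With a spare third color `d`, any two proper `2`-colorings are connected. -/
theorem reach_succAbove_comp {V : Type*} [Finite V] {B : SimpleGraph V} (d : Fin 3)
    {p q : V → Fin 2} (hp : Proper B 2 p) (hq : Proper B 2 q) :
    Reach B 3 (d.succAbove ∘ p) (d.succAbove ∘ q) := by
  have hp' : Proper B 3 (d.succAbove ∘ p) := fun u v huv h =>
    hp huv (Fin.succAbove_right_injective h)
  have hq' : Proper B 3 (d.succAbove ∘ q) := fun u v huv h =>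
    hq huv (Fin.succAbove_right_injective h)
  let move (r : V → Fin 2) (v : V) : Fin 3 := if p v = 0 ∧ q v = 1 then d else d.succAbove (r v)
  have hcases : ∀ d : Fin 3, ∀ a a' b b' : Fin 2, a ≠ a' → b ≠ b' →
      d.succAbove a ≠ (if a' = 0 ∧ b' = 1 then d else d.succAbove a') ∧
      (if a = 0 ∧ b = 1 then d else d.succAbove a) ≠
        (if a' = 0 ∧ b' = 1 then d else d.succAbove a') ∧
      (if a = 0 ∧ b = 1 then d else d.succAbove a) ≠
        (if a' = 0 ∧ b' = 1 then d else d.succAbove b') ∧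
      (if a = 0 ∧ b = 1 then d else d.succAbove b) ≠
        (if a' = 0 ∧ b' = 1 then d else d.succAbove b') ∧
      (if a = 0 ∧ b = 1 then d else d.succAbove b) ≠ d.succAbove b' := by
    decide
  have hall {u v : V} (huv : B.Adj u v) := hcases d _ _ _ _ (hp huv) (hq huv)
  have h₁ : Proper B 3 (move p) := fun u v huv => (hall huv).2.1
  have h₂ : Proper B 3 (move q) := fun u v huv => (hall huv).2.2.2.1
  exact (reach_of_forall_adj_ne hp' h₁ fun u v huv => (hall huv).1).trans <|
    (reach_of_forall_adj_ne h₁ h₂ fun u v huv => (hall huv).2.2.1).trans <|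
    reach_of_forall_adj_ne h₂ hq' fun u v huv => (hall huv).2.2.2.2

theorem exists_eq_succAbove_comp {V : Type*} {n : ℕ} {c : V → Fin (n + 1)}
    (hc : (Set.range c).ncard ≤ n) : ∃ d : Fin (n + 1), ∃ p : V → Fin n, c = d.succAbove ∘ p := by
  obtain ⟨d, hd⟩ : ∃ d, d ∉ Set.range c := by
    by_contra! h
    rw [Set.eq_univ_of_forall h, Set.ncard_univ, Nat.card_fin] at hc
    omega
  choose p hp using fun v => Fin.exists_succAbove_eq (fun h => hd ⟨v, h⟩ : c v ≠ d)
  exact ⟨d, p, funext fun v => (hp v).symm⟩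

theorem proper_joinK_iff {V : Type*} {B : SimpleGraph V} {m k : ℕ} {c : V ⊕ Fin m → Fin k} :
    Proper (JoinK B m) k c ↔ Proper B k (c ∘ Sum.inl) ∧ Function.Injective (c ∘ Sum.inr) ∧
      ∀ v i, c (Sum.inl v) ≠ c (Sum.inr i) := by
  constructor
  · intro h
    refine ⟨fun u v huv => h ?_, fun i j hij => by_contra fun hne => h ?_ hij, fun v i => h ?_⟩
    · simp [JoinK, huv, huv.ne]
    · simp [JoinK, hne]
    · simp [JoinK]
  · rintro ⟨h₁, h₂, h₃⟩ (u | i) (v | j) huv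
    · refine h₁ ?_
      simp only [JoinK, SimpleGraph.fromRel_adj] at huv
      exact huv.2.elim id fun h => h.symm
    · exact h₃ u j
    · exact (h₃ v i).symm
    · exact fun h => huv.ne (congrArg _ (h₂ h))

/-- Recoloring sequences of `B` extend to the join when the apex colors are avoided. -/
theorem Reach.joinK {V : Type*} {B : SimpleGraph V} {n m k : ℕ} {e : Fin n → Fin k}
    (he : Function.Injective e) {f : Fin m → Fin k} (hf : Function.Injective f)
    (hef : ∀ x i, e x ≠ f i) {c c' : V → Fin n} (h : Reach B n c c') :
    Reach (JoinK B m) k (Sum.elim (e ∘ c) f) (Sum.elim (e ∘ c') f) := by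
  have hproper {c : V → Fin n} (hc : Proper B n c) :
      Proper (JoinK B m) k (Sum.elim (e ∘ c) f) :=
    proper_joinK_iff.2 ⟨fun u v huv h => hc huv (he h), hf, fun v i => hef _ _⟩
  refine Relation.ReflTransGen.lift (p := ColAdj (JoinK B m) k) (fun c => Sum.elim (e ∘ c) f)
    (fun c₁ c₂ hadj => ?_) _ _ h
  obtain ⟨h₁, h₂, v, hv, huniq⟩ := hadj
  refine ⟨hproper h₁, hproper h₂, Sum.inl v, he.ne hv, ?_⟩
  rintro (w | i) hw
  · exact congrArg _ (huniq w fun h => hw (congrArg e h))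
  · exact (hw rfl).elim

/-- A proper `2`-coloring of `B` induces a homomorphism from the join to a complete graph. -/
def joinKHom {V : Type*} {B : SimpleGraph V} (m : ℕ) {p : V → Fin 2} (hp : Proper B 2 p) :
    JoinK B m →g (⊤ : SimpleGraph (Fin 2 ⊕ Fin m)) where
  toFun := Sum.map p id
  map_rel' := by
    rintro (u | i) (v | j) huv
    · simp only [JoinK, SimpleGraph.fromRel_adj] at huv
      simpa using huv.2.elim (fun h => hp h) fun h => hp h.symm
    · simp
    · simp
    · simpa using huv.ne

/-- Every coloring of the join reaches one that factors through the given `2`-coloring of `B`. -/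
theorem exists_reach_comp_joinKHom {V : Type*} [Finite V] {B : SimpleGraph V} {m : ℕ}
    {p : V → Fin 2} (hp : Proper B 2 p)
    (h : ∀ c : V → Fin 3, Proper B 3 c →
      ∃ c' : V → Fin 3, Reach B 3 c c' ∧ (Set.range c').ncard ≤ 2)
    {c : V ⊕ Fin m → Fin (m + 3)} (hc : Proper (JoinK B m) (m + 3) c) :
    ∃ g : Fin 2 ⊕ Fin m → Fin (m + 3), Function.Injective g ∧
      Reach (JoinK B m) (m + 3) c (g ∘ joinKHom m hp) := by
  classical
  obtain ⟨hB, hf, hBf⟩ := proper_joinK_iff.1 hc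
  set f := c ∘ Sum.inr
  have hcard : ((Finset.univ.image f)ᶜ).card = 3 := by
    simp [Finset.card_compl, Finset.card_image_of_injective _ hf]
  let e := ((Finset.univ.image f)ᶜ).orderEmbOfFin hcard
  have hmem (x : Fin (m + 3)) : x ∈ Set.range e ↔ ∀ i, f i ≠ x := by
    simp [e]
  have hef (x i) : e x ≠ f i := ((hmem _).1 ⟨x, rfl⟩ i).symm
  choose c₁ hc₁ using fun v => (hmem (c (Sum.inl v))).2 fun i => (hBf v i).symm
  have hc_eq : c = Sum.elim (e ∘ c₁) f := by
    ext (v | i)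
    · simp [hc₁]
    · rfl
  have hc₁_proper : Proper B 3 c₁ := fun u v huv heq => hB huv (by simp [← hc₁, heq])
  obtain ⟨c₂, hreach, hrange⟩ := h c₁ hc₁_proper
  obtain ⟨d, q, rfl⟩ := exists_eq_succAbove_comp hrange
  have hq : Proper B 2 q := fun u v huv heq =>
    hreach.proper hc₁_proper huv (congrArg d.succAbove heq)
  refine ⟨Sum.elim (e ∘ d.succAbove) f, ?_, ?_⟩
  · exact (e.injective.comp Fin.succAbove_right_injective).sumElim hf fun x i => hef _ i
  · have := Reach.joinK e.injective hf hef (hreach.trans (reach_succAbove_comp d hq hp))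
    rw [hc_eq]
    convert this using 1
    ext (v | i) <;> rfl

/-- if `B` is bipartite and every proper `3`-coloring of `B` can be
transformed into one using at most `2` colors, then the join of `B` with
`K_{k-3}` is `k`-mixing. -/
theorem stmt7 {V : Type*} [Fintype V] (k : ℕ) (hk : 4 ≤ k)
    (B : SimpleGraph V) (hbip : Bipartite B)
    (h : ∀ c : V → Fin 3, Proper B 3 c →
      ∃ c' : V → Fin 3, Reach B 3 c c' ∧ (Set.range c').ncard ≤ 2) :
    Mixing (JoinK B (k - 3)) k := by
  obtain ⟨m, rfl⟩ : ∃ m, k = m + 3 := ⟨k - 3, by omega⟩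
  obtain ⟨p, hp⟩ := hbip
  rw [Nat.add_sub_cancel]
  intro c c' hc hc'
  obtain ⟨g, hg, hcg⟩ := exists_reach_comp_joinKHom hp h hc
  obtain ⟨g', hg', hcg'⟩ := exists_reach_comp_joinKHom hp h hc'
  have hgg' : Reach ⊤ (m + 3) g g' :=
    mixing_top (by simp; omega) g g' (proper_top_iff.2 hg) (proper_top_iff.2 hg')
  exact hcg.trans ((hgg'.comp_hom _).trans hcg'.symm)
end

section
/- Let k ≥ 4, let B be a finite simple graph on vertex set V, let G be the join of B with the complete graph on k−3 vertices, and let B₁, B₂ be sets partitioning V. Let c₁ and c₂ be proper k-colorings of G such that c₁ is constant on each of B₁ and B₂ (on the copy of V in G) and c₂ is constant on each of B₁ and B₂. Then c₁ can be transformed into c₂ by single-vertex recolorings through proper k-colorings of G. -/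
theorem Reach.of_proper_of_differ_independent {W : Type*} [Finite W] {G : SimpleGraph W} {k : ℕ}
    {c d : W → Fin k} (hc : Proper G k c) (hd : Proper G k d)
    (h : ∀ u v, G.Adj u v → c u ≠ d u → c v = d v) : Reach G k c d := by
  classical
  obtain ⟨n, hn⟩ : ∃ n, {v | c v ≠ d v}.ncard = n := ⟨_, rfl⟩
  induction n using Nat.strong_induction_on generalizing c with
  | _ n ih =>
    by_cases hcd : c = d
    · subst hcd
      exact Relation.ReflTransGen.refl
    obtain ⟨w, hw⟩ := Function.ne_iff.mp hcd
    have hc' : Proper G k (Function.update c w (d w)) := by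
      intro u v huv
      have huvne := huv.ne
      by_cases hu : u = w
      · subst hu
        have hv := h u v huv hw
        simpa [Function.update_of_ne huvne.symm, hv] using hd huv
      · by_cases hv : v = w
        · subst hv
          have hu' := h v u huv.symm hw
          simpa [Function.update_of_ne huvne, hu'] using hd huv
        · simpa [Function.update_of_ne hu, Function.update_of_ne hv] using hc huv
    have hdiff : ∀ v, Function.update c w (d w) v ≠ d v → v ≠ w ∧ c v ≠ d v := by
      intro v hv
      by_cases hvw : v = w
      · subst hvw
        simp at hv
      · exact ⟨hvw, by simpa [Function.update_of_ne hvw] using hv⟩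
    refine Relation.ReflTransGen.head (b := Function.update c w (d w)) ⟨hc, hc', w, ?_, ?_⟩
      (ih _ ?_ hc' ?_ rfl)
    · simpa using hw
    · intro v hv
      by_contra hvw
      simp [Function.update_of_ne hvw] at hv
    · rw [← hn]
      refine Set.ncard_lt_ncard ⟨fun v hv => (hdiff v hv).2, fun hs => ?_⟩ (Set.toFinite _)
      exact (hdiff w (hs hw)).1 rfl
    · intro u v huv hu
      by_contra hv
      exact (hdiff v hv).2 (h u v huv (hdiff u hu).2)

theorem Proper.comp_of_injective {W T : Type*} {G : SimpleGraph W} {k : ℕ} {p : W → T}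
    (hp : ∀ u v, G.Adj u v → p u ≠ p v) {g : T → Fin k} (hg : Function.Injective g) :
    Proper G k (g ∘ p) :=
  fun u v huv he => hp u v huv (hg he)

theorem Function.Injective.update_of_notMem_range {T C : Type*} [DecidableEq T] {g : T → C}
    (hg : Function.Injective g) (t : T) {s : C} (hs : s ∉ Set.range g) :
    Function.Injective (Function.update g t s) := by
  have hs' : ∀ a, g a ≠ s := fun a ha => hs ⟨a, ha⟩
  intro a b hab
  by_cases ha : a = t <;> by_cases hb : b = t
  · rw [ha, hb]
  · subst ha
    simp only [Function.update_self, Function.update_of_ne hb] at hab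
    exact absurd hab.symm (hs' b)
  · subst hb
    simp only [Function.update_self, Function.update_of_ne ha] at hab
    exact absurd hab (hs' a)
  · simp only [Function.update_of_ne ha, Function.update_of_ne hb] at hab
    exact hg hab

theorem Reach.comp_update {W T : Type*} [Finite W] [DecidableEq T] {G : SimpleGraph W} {k : ℕ}
    {p : W → T} (hp : ∀ u v, G.Adj u v → p u ≠ p v) {g : T → Fin k}
    (hg : Function.Injective g) (t : T) {s : Fin k} (hs : s ∉ Set.range g) :
    Reach G k (g ∘ p) (Function.update g t s ∘ p) := by
  refine Reach.of_proper_of_differ_independent (Proper.comp_of_injective hp hg)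
    (Proper.comp_of_injective hp (hg.update_of_notMem_range t hs)) fun u v huv hu => ?_
  have hut : p u = t := by
    by_contra hne
    simp [Function.update_of_ne hne] at hu
  have hvt : p v ≠ t := fun hv => hp u v huv (hut.trans hv.symm)
  simp [Function.update_of_ne hvt]

/-- Colorings that factor through a homomorphism to a complete graph on fewer than `k` vertices
are all connected to each other. -/
theorem Reach.comp_of_injective {W T : Type*} [Finite W] [Fintype T] {G : SimpleGraph W} {k : ℕ}
    {p : W → T} (hp : ∀ u v, G.Adj u v → p u ≠ p v) (hT : Fintype.card T < k)
    {g g' : T → Fin k} (hg : Function.Injective g) (hg' : Function.Injective g') :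
    Reach G k (g ∘ p) (g' ∘ p) := by
  classical
  obtain ⟨n, hn⟩ : ∃ n, {t | g t ≠ g' t}.ncard = n := ⟨_, rfl⟩
  induction n using Nat.strong_induction_on generalizing g with
  | _ n ih =>
    by_cases hgg : g = g'
    · subst hgg
      exact Relation.ReflTransGen.refl
    by_cases hfree : ∃ t, g' t ∉ Set.range g
    · obtain ⟨t, ht⟩ := hfree
      refine (Reach.comp_update hp hg t ht).trans
        (ih _ ?_ (hg.update_of_notMem_range t ht) rfl)
      rw [← hn]
      refine Set.ncard_lt_ncard ⟨fun v hv => ?_, fun hs => ?_⟩ (Set.toFinite _)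
      · have hvt : v ≠ t := by
          rintro rfl
          simp at hv
        simpa [Function.update_of_ne hvt] using hv
      · simpa using hs (show g t ≠ g' t from fun he => ht ⟨t, he⟩)
    · push Not at hfree
      obtain ⟨t₀, ht₀⟩ := Function.ne_iff.mp hgg
      obtain ⟨s, hs⟩ : ∃ s, s ∉ Set.range g := by
        by_contra! hsurj
        have := Fintype.card_le_of_surjective g hsurj
        rw [Fintype.card_fin] at this
        omega
      have hrange : Set.range g' = Set.range g := by
        refine Set.eq_of_subset_of_ncard_le (Set.range_subset_iff.mpr hfree) ?_ (Set.toFinite _)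
        rw [← Set.image_univ, ← Set.image_univ, Set.ncard_image_of_injective _ hg,
          Set.ncard_image_of_injective _ hg']
      obtain ⟨t, ht⟩ : g t₀ ∈ Set.range g' := hrange ▸ Set.mem_range_self t₀
      have htt₀ : t ≠ t₀ := by
        rintro rfl
        exact ht₀ ht.symm
      have hg₁ := hg.update_of_notMem_range t₀ hs
      have hfree₁ : g' t ∉ Set.range (Function.update g t₀ s) := by
        rintro ⟨a, ha⟩
        rw [ht] at ha
        by_cases hat : a = t₀
        · subst hat
          rw [Function.update_self] at ha
          exact hs ⟨a, ha.symm⟩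
        · rw [Function.update_of_ne hat] at ha
          exact hat (hg ha)
      refine ((Reach.comp_update hp hg t₀ hs).trans (Reach.comp_update hp hg₁ t hfree₁)).trans
        (ih _ ?_ (hg₁.update_of_notMem_range t hfree₁) rfl)
      rw [← hn]
      refine Set.ncard_lt_ncard ⟨fun v hv => ?_, fun hss => ?_⟩ (Set.toFinite _)
      · by_cases hv₀ : v = t₀
        · exact hv₀ ▸ ht₀
        have hvt : v ≠ t := by
          rintro rfl
          simp at hv
        simpa [Function.update_of_ne hvt, Function.update_of_ne hv₀] using hv
      · have hgt : g t ≠ g' t := fun he => htt₀ (hg (he.trans ht))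
        simpa using hss hgt

open Classical in
/-- The projection of the join of a bipartite graph and `K_m` onto a set of size `m + 2`,
collapsing `S` to `none` and its complement in `V` to `some none`. -/
noncomputable def JoinK.proj {V : Type*} (S : Set V) (m : ℕ) : V ⊕ Fin m → Option (Option (Fin m))
  | Sum.inl v => if v ∈ S then none else some none
  | Sum.inr i => some (some i)

theorem JoinK.proj_ne {V : Type*} {B : SimpleGraph V} {m : ℕ} {S : Set V}
    (hS : ∀ u v, B.Adj u v → (u ∈ S ↔ v ∉ S)) (x y : V ⊕ Fin m) (h : (JoinK B m).Adj x y) :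
    JoinK.proj S m x ≠ JoinK.proj S m y := by
  rcases x with u | i <;> rcases y with v | j
  · have huv : B.Adj u v := by
      simpa [JoinK, B.adj_comm v u, B.ne_of_adj] using h.2
    have := hS u v huv
    by_cases hu : u ∈ S <;> by_cases hv : v ∈ S <;> simp_all [JoinK.proj]
  · by_cases hu : u ∈ S <;> simp [JoinK.proj, hu]
  · by_cases hv : v ∈ S <;> simp [JoinK.proj, hv]
  · have hij := h.ne
    simpa [JoinK.proj] using hij

/-- A coloring constant on `Sᶜ` agrees, outside the independent set `S`, with a coloring that
factors injectively through `JoinK.proj`. -/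
theorem Proper.exists_injective_eq_proj {V : Type*} {B : SimpleGraph V} {k m : ℕ} {S : Set V}
    (hm : m + 2 ≤ k) {c : V ⊕ Fin m → Fin k} (hc : Proper (JoinK B m) k c)
    (hconst : ∀ u ∉ S, ∀ v ∉ S, c (Sum.inl u) = c (Sum.inl v)) :
    ∃ g : Option (Option (Fin m)) → Fin k, Function.Injective g ∧
      ∀ x, c x ≠ g (JoinK.proj S m x) → ∃ v ∈ S, x = Sum.inl v := by
  classical
  have hf : Function.Injective fun i : Fin m => c (Sum.inr i) := by
    intro i j hij
    by_contra hne
    exact hc (show (JoinK B m).Adj (Sum.inr i) (Sum.inr j) by simp [JoinK, hne]) hij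
  have hfresh : ∀ s : Finset (Fin k), s.card < k → ∃ a, a ∉ s := by
    intro s hs
    by_contra! h
    rw [Finset.eq_univ_iff_forall.mpr h, Finset.card_univ, Fintype.card_fin] at hs
    exact hs.false
  set F : Finset (Fin k) := Finset.univ.image fun i : Fin m => c (Sum.inr i) with hF
  have hFcard : F.card = m := by
    rw [hF, Finset.card_image_of_injective _ hf, Finset.card_univ, Fintype.card_fin]
  obtain ⟨b, hbF, hb⟩ : ∃ b, b ∉ F ∧ ∀ v ∉ S, c (Sum.inl v) = b := by
    by_cases hne : ∃ v, v ∉ S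
    · obtain ⟨v, hv⟩ := hne
      refine ⟨c (Sum.inl v), ?_, fun u hu => hconst u hu v hv⟩
      simp only [hF, Finset.mem_image, Finset.mem_univ, true_and, not_exists]
      exact fun i => hc (show (JoinK B m).Adj (Sum.inr i) (Sum.inl v) by simp [JoinK])
    · obtain ⟨b, hb⟩ := hfresh F (by omega)
      exact ⟨b, hb, fun v hv => absurd ⟨v, hv⟩ hne⟩
  obtain ⟨a, ha⟩ := hfresh (insert b F) (by rw [Finset.card_insert_of_notMem hbF]; omega)
  simp only [hF, Finset.mem_insert, Finset.mem_image, Finset.mem_univ, true_and, not_or,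
    not_exists] at ha hbF
  refine ⟨fun t => t.elim a fun t => t.elim b fun i => c (Sum.inr i), ?_, ?_⟩
  · rintro (_ | _ | i) (_ | _ | j) h
    all_goals simp only [Option.elim] at h
    · rfl
    · exact absurd h ha.1
    · exact absurd h.symm (ha.2 j)
    · exact absurd h.symm ha.1
    · rfl
    · exact absurd h.symm (hbF j)
    · exact absurd h (ha.2 i)
    · exact absurd h (hbF i)
    · rw [hf h]
  · rintro (v | i) hx
    · refine ⟨v, ?_, rfl⟩
      by_contra hv
      exact hx (by simp [JoinK.proj, hv, hb v hv])
    · exact absurd rfl hx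

/-- two proper `k`-colorings of the join which are each constant on
the two parts `B₁, B₂` of a partition of `V` can be transformed into one
another. -/
theorem stmt8 {V : Type*} [Fintype V] (k : ℕ) (hk : 4 ≤ k)
    (B : SimpleGraph V) (B₁ B₂ : Set V)
    (hunion : B₁ ∪ B₂ = Set.univ) (hdisj : Disjoint B₁ B₂)
    (c₁ c₂ : (V ⊕ Fin (k - 3)) → Fin k)
    (hc₁ : Proper (JoinK B (k - 3)) k c₁) (hc₂ : Proper (JoinK B (k - 3)) k c₂)
    (hc₁B₁ : ∀ u ∈ B₁, ∀ v ∈ B₁, c₁ (Sum.inl u) = c₁ (Sum.inl v))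
    (hc₁B₂ : ∀ u ∈ B₂, ∀ v ∈ B₂, c₁ (Sum.inl u) = c₁ (Sum.inl v))
    (hc₂B₁ : ∀ u ∈ B₁, ∀ v ∈ B₁, c₂ (Sum.inl u) = c₂ (Sum.inl v))
    (hc₂B₂ : ∀ u ∈ B₂, ∀ v ∈ B₂, c₂ (Sum.inl u) = c₂ (Sum.inl v)) :
    Reach (JoinK B (k - 3)) k c₁ c₂ := by
  have hB₂ : ∀ v, v ∉ B₁ ↔ v ∈ B₂ := fun v =>
    ⟨fun hv => ((hunion ▸ Set.mem_univ v : v ∈ B₁ ∪ B₂)).resolve_left hv,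
      fun hv hv' => Set.disjoint_left.mp hdisj hv' hv⟩
  have hbip : ∀ u v, B.Adj u v → (u ∈ B₁ ↔ v ∉ B₁) := by
    intro u v huv
    have hne : c₁ (Sum.inl u) ≠ c₁ (Sum.inl v) :=
      hc₁ (show (JoinK B (k - 3)).Adj (Sum.inl u) (Sum.inl v) by simp [JoinK, huv, huv.ne])
    refine ⟨fun hu hv => hne (hc₁B₁ u hu v hv), fun hv => ?_⟩
    by_contra hu
    exact hne (hc₁B₂ u ((hB₂ u).mp hu) v ((hB₂ v).mp hv))
  have hp := JoinK.proj_ne (m := k - 3) hbip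
  have hind : ∀ x y, (JoinK B (k - 3)).Adj x y → (∃ u ∈ B₁, x = Sum.inl u) →
      ¬ ∃ v ∈ B₁, y = Sum.inl v := by
    rintro _ _ hxy ⟨u, hu, rfl⟩ ⟨v, hv, rfl⟩
    exact hp _ _ hxy (by simp [JoinK.proj, hu, hv])
  obtain ⟨g₁, hg₁, hd₁⟩ := hc₁.exists_injective_eq_proj (S := B₁) (by omega)
    fun u hu v hv => hc₁B₂ u ((hB₂ u).mp hu) v ((hB₂ v).mp hv)
  obtain ⟨g₂, hg₂, hd₂⟩ := hc₂.exists_injective_eq_proj (S := B₁) (by omega)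
    fun u hu v hv => hc₂B₂ u ((hB₂ u).mp hu) v ((hB₂ v).mp hv)
  have hstart : Reach (JoinK B (k - 3)) k c₁ (g₁ ∘ JoinK.proj B₁ (k - 3)) :=
    Reach.of_proper_of_differ_independent hc₁ (Proper.comp_of_injective hp hg₁)
      fun x y hxy hx => by_contra fun hy => hind x y hxy (hd₁ x hx) (hd₁ y hy)
  have hend : Reach (JoinK B (k - 3)) k (g₂ ∘ JoinK.proj B₁ (k - 3)) c₂ :=
    Reach.of_proper_of_differ_independent (Proper.comp_of_injective hp hg₂) hc₂
      fun x y hxy hx => by_contra fun hy =>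
        hind x y hxy (hd₂ x (Ne.symm hx)) (hd₂ y (Ne.symm hy))
  exact (hstart.trans
    (Reach.comp_of_injective hp (by simp; omega) hg₁ hg₂)).trans hend
end
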